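/- Let u : ℝ^d → ℝ be three times continuously differentiable with ∇u ℤ^d-periodic and ∇u(x) ≠ 0 for every x. Let X : ℝ × ℝ^d → ℝ^d satisfy X(0,x) = x and ∂X/∂t(t,x) = ∇u(X(t,x)), and let τ : ℝ^d → ℝ be such that u(X(τ(x),x)) = 0 for every x. Suppose σ : ℝ^d → ℝ is continuously differentiable, ℤ^d-periodic, with σ(x) > 0 for all x, and div(σ∇u) = σΔu + ∇σ·∇u = 0 everywhere in ℝ^d. Then ∫₀^{τ(x)} Δu(X(t,x)) dt = ln σ(x) − ln σ(X(τ(x),x)) for every x, and in particular there exists a constant C > 0 such that |∫₀^{τ(x)} Δu(X(t,x)) dt| ≤ C for all x ∈ ℝ^d. (Theorem 2.4, necessity of the boundedness condition for isotropic realizability in the torus.) -/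

import Mathlib

open MeasureTheory
open scoped RealInnerProductSpace

/-- A continuous `ℤ^d`-periodic real function is bounded. -/
lemma exists_abs_le_of_continuous_of_periodic {d : ℕ} {f : EuclideanSpace ℝ (Fin d) → ℝ}
    (hf : Continuous f)
    (hper : ∀ (x : EuclideanSpace ℝ (Fin d)) (k : Fin d → ℤ),
      f (x + (WithLp.equiv 2 (Fin d → ℝ)).symm (fun i => (k i : ℝ))) = f x) :
    ∃ M : ℝ, ∀ x, |f x| ≤ M := by
  have hK : IsCompact (WithLp.toLp 2 '' Set.Icc (0 : Fin d → ℝ) 1) :=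
    isCompact_Icc.image (PiLp.continuous_toLp 2 _)
  obtain ⟨M, hM⟩ := hK.exists_bound_of_continuousOn hf.continuousOn
  refine ⟨M, fun x => ?_⟩
  have hx : x = WithLp.toLp 2 (fun i => Int.fract (x i)) +
      (WithLp.equiv 2 (Fin d → ℝ)).symm (fun i => (⌊x i⌋ : ℝ)) := by
    ext i
    simp
  rw [hx, hper]
  exact hM _ ⟨_, ⟨fun i => Int.fract_nonneg _, fun i => (Int.fract_lt_one _).le⟩, rfl⟩

lemma ContDiff.continuous_gradient_of_one_le {E : Type*} [NormedAddCommGroup E]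
    [InnerProductSpace ℝ E] [CompleteSpace E] {f : E → ℝ} {n : WithTop ℕ∞}
    (hf : ContDiff ℝ n f) (hn : 1 ≤ n) : Continuous (gradient f) :=
  (InnerProductSpace.toDual ℝ E).symm.continuous.comp
    (hf.continuous_fderiv (ne_of_gt (zero_lt_one.trans_le hn)))

/-- **Theorem 2.4** (necessity of the boundedness condition): if `∇u` is isotropically
realizable with a positive `C¹` `ℤ^d`-periodic conductivity `σ`, then along the gradient flow
`∫₀^{τ(x)} Δu(X(t,x)) dt = ln σ(x) - ln σ(X(τ(x),x))`, hence this integral is bounded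
uniformly in `x`. -/
theorem boundedness_necessary_for_torus_realizability (d : ℕ)
    (u : EuclideanSpace ℝ (Fin d) → ℝ) (hu : ContDiff ℝ 3 u)
    (hper : ∀ (x : EuclideanSpace ℝ (Fin d)) (k : Fin d → ℤ),
      gradient u (x + (WithLp.equiv 2 (Fin d → ℝ)).symm (fun i => (k i : ℝ))) = gradient u x)
    (hnz : ∀ x, gradient u x ≠ 0)
    (X : ℝ × EuclideanSpace ℝ (Fin d) → EuclideanSpace ℝ (Fin d))
    (hX0 : ∀ x, X (0, x) = x)
    (hXt : ∀ t x, HasDerivAt (fun s => X (s, x)) (gradient u (X (t, x))) t)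
    (τ : EuclideanSpace ℝ (Fin d) → ℝ)
    (hτ : ∀ x, u (X (τ x, x)) = 0)
    (Δu : EuclideanSpace ℝ (Fin d) → ℝ)
    (hΔu : ∀ x, Δu x = LinearMap.trace ℝ (EuclideanSpace ℝ (Fin d))
      (fderiv ℝ (gradient u) x : EuclideanSpace ℝ (Fin d) →ₗ[ℝ] EuclideanSpace ℝ (Fin d)))
    (σ : EuclideanSpace ℝ (Fin d) → ℝ) (hσreg : ContDiff ℝ 1 σ)
    (hσper : ∀ (x : EuclideanSpace ℝ (Fin d)) (k : Fin d → ℤ),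
      σ (x + (WithLp.equiv 2 (Fin d → ℝ)).symm (fun i => (k i : ℝ))) = σ x)
    (hσpos : ∀ x, 0 < σ x)
    (hdiv : ∀ x, σ x * Δu x + ⟪gradient σ x, gradient u x⟫ = 0) :
    (∀ x, (∫ t in (0:ℝ)..(τ x), Δu (X (t, x)))
      = Real.log (σ x) - Real.log (σ (X (τ x, x)))) ∧
    ∃ C : ℝ, 0 < C ∧ ∀ x, |∫ t in (0:ℝ)..(τ x), Δu (X (t, x))| ≤ C := by
  have hσ0 : ∀ x, σ x ≠ 0 := fun x => (hσpos x).ne'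
  have hΔ : ∀ x, Δu x = -(⟪gradient σ x, gradient u x⟫ / σ x) := fun x => by
    have := hσ0 x
    field_simp
    linarith [hdiv x]
  have hΔc : Continuous Δu := by
    rw [funext hΔ]
    exact (((hσreg.continuous_gradient_of_one_le le_rfl).inner
      (hu.continuous_gradient_of_one_le (by norm_num))).div hσreg.continuous hσ0).neg
  have hformula : ∀ x, (∫ t in (0:ℝ)..(τ x), Δu (X (t, x)))
      = Real.log (σ x) - Real.log (σ (X (τ x, x))) := by
    intro x
    have hXc : Continuous fun t => X (t, x) :=
      continuous_iff_continuousAt.2 fun t => (hXt t x).continuousAt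
    have hderiv : ∀ t, HasDerivAt (fun s => -Real.log (σ (X (s, x)))) (Δu (X (t, x))) t := by
      intro t
      have hσd := (hσreg.differentiable one_ne_zero (X (t, x))).hasGradientAt.hasFDerivAt
      have h := ((hσd.comp_hasDerivAt t (hXt t x)).log (hσ0 _)).neg
      rw [hΔ]
      exact h
    rw [intervalIntegral.integral_eq_sub_of_hasDerivAt (fun t _ => hderiv t)
      ((hΔc.comp hXc).intervalIntegrable _ _), hX0]
    ring
  refine ⟨hformula, ?_⟩
  obtain ⟨M, hM⟩ := exists_abs_le_of_continuous_of_periodic (hσreg.continuous.log hσ0)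
    fun x k => by rw [hσper]
  have hM0 : 0 ≤ M := (abs_nonneg _).trans (hM 0)
  refine ⟨2 * M + 1, by linarith, fun x => ?_⟩
  rw [hformula]
  linarith [abs_sub (Real.log (σ x)) (Real.log (σ (X (τ x, x)))), hM x, hM (X (τ x, x))]
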